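/- Let X be a nonempty perfect topological space of the first category in itself possessing a countable π-base. Then there exist disjoint subsets A and B of X, each of which is simultaneously an F_σ-set and a G_δ-set in X, such that A and B are both dense in X and X = A ∪ B. -/

import Mathlib

open Set

universe u v

/-- `A` is functionally open in `X`: `A = f⁻¹((0,1])` for some continuous `f : X → [0,1]`. -/
def FunctionallyOpen (X : Type u) [TopologicalSpace X] (A : Set X) : Prop :=
  ∃ f : X → ℝ, Continuous f ∧ (∀ x, f x ∈ Set.Icc (0:ℝ) 1) ∧ A = f ⁻¹' (Set.Ioc 0 1)

/-- `A` is functionally closed in `X`: `A = f⁻¹(0)` for some continuous `f : X → [0,1]`. -/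
def FunctionallyClosed (X : Type u) [TopologicalSpace X] (A : Set X) : Prop :=
  ∃ f : X → ℝ, Continuous f ∧ (∀ x, f x ∈ Set.Icc (0:ℝ) 1) ∧ A = f ⁻¹' {0}

mutual
/-- The `α`'th functionally additive class in `X`. -/
inductive FunAdd (X : Type u) [TopologicalSpace X] : Ordinal.{0} → Set X → Prop where
  | base (A : Set X) : FunctionallyOpen X A → FunAdd X 0 A
  | union (α : Ordinal.{0}) (hα : α ≠ 0) (β : ℕ → Ordinal.{0}) (hβ : ∀ n, β n < α)
      (s : ℕ → Set X) (hs : ∀ n, FunMul X (β n) (s n)) : FunAdd X α (⋃ n, s n)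

/-- The `α`'th functionally multiplicative class in `X`. -/
inductive FunMul (X : Type u) [TopologicalSpace X] : Ordinal.{0} → Set X → Prop where
  | base (A : Set X) : FunctionallyClosed X A → FunMul X 0 A
  | inter (α : Ordinal.{0}) (hα : α ≠ 0) (β : ℕ → Ordinal.{0}) (hβ : ∀ n, β n < α)
      (s : ℕ → Set X) (hs : ∀ n, FunAdd X (β n) (s n)) : FunMul X α (⋂ n, s n)
end

mutual
/-- The `α`'th (ordinary) additive Borel class in `X`. -/
inductive BorelAdd (X : Type u) [TopologicalSpace X] : Ordinal.{0} → Set X → Prop where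
  | base (A : Set X) : IsOpen A → BorelAdd X 0 A
  | union (α : Ordinal.{0}) (hα : α ≠ 0) (β : ℕ → Ordinal.{0}) (hβ : ∀ n, β n < α)
      (s : ℕ → Set X) (hs : ∀ n, BorelMul X (β n) (s n)) : BorelAdd X α (⋃ n, s n)

/-- The `α`'th (ordinary) multiplicative Borel class in `X`. -/
inductive BorelMul (X : Type u) [TopologicalSpace X] : Ordinal.{0} → Set X → Prop where
  | base (A : Set X) : IsClosed A → BorelMul X 0 A
  | inter (α : Ordinal.{0}) (hα : α ≠ 0) (β : ℕ → Ordinal.{0}) (hβ : ∀ n, β n < α)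
      (s : ℕ → Set X) (hs : ∀ n, BorelAdd X (β n) (s n)) : BorelMul X α (⋂ n, s n)
end

/-- A set is functionally ambiguous of class `α` if it belongs to both the `α`'th functionally
additive and the `α`'th functionally multiplicative class. -/
def FunAmbiguous (X : Type u) [TopologicalSpace X] (α : Ordinal.{0}) (A : Set X) : Prop :=
  FunAdd X α A ∧ FunMul X α A

/-- `f ∈ K_α(X,Y)`: for `α = 0` continuity, for `α > 0` preimages of open sets belong to
the `α`'th functionally additive class. -/
def KClass {X : Type u} {Y : Type v} [TopologicalSpace X] [TopologicalSpace Y]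
    (α : Ordinal.{0}) (f : X → Y) : Prop :=
  (α = 0 → Continuous f) ∧ (α ≠ 0 → ∀ V : Set Y, IsOpen V → FunAdd X α (f ⁻¹' V))

/-- `A` and `B` are `α`-separated in `X`. -/
def AlphaSeparated {X : Type u} [TopologicalSpace X] (α : Ordinal.{0}) (A B : Set X) : Prop :=
  ∃ f : X → ℝ, KClass α f ∧ A ⊆ f ⁻¹' {0} ∧ B ⊆ f ⁻¹' {1}

/-- `X` is an `α`-separated space: any two disjoint sets of the `α`'th (ordinary)
multiplicative class are `α`-separated. -/
def AlphaSeparatedSpace (X : Type u) [TopologicalSpace X] (α : Ordinal.{0}) : Prop :=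
  ∀ A B : Set X, BorelMul X α A → BorelMul X α B → Disjoint A B → AlphaSeparated α A B

/-- `E` is `α`-embedded in `X`. -/
def AlphaEmbedded {X : Type u} [TopologicalSpace X] (α : Ordinal.{0}) (E : Set X) : Prop :=
  (∀ A : Set ↥E, FunAdd ↥E α A → ∃ B : Set X, FunAdd X α B ∧ Subtype.val '' A = B ∩ E) ∧
  (∀ A : Set ↥E, FunMul ↥E α A → ∃ B : Set X, FunMul X α B ∧ Subtype.val '' A = B ∩ E)

/-- `E` is ambiguously `α`-embedded in `X`. -/
def AmbiguouslyEmbedded {X : Type u} [TopologicalSpace X] (α : Ordinal.{0}) (E : Set X) : Prop :=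
  ∀ A : Set ↥E, FunAmbiguous ↥E α A →
    ∃ B : Set X, FunAmbiguous X α B ∧ Subtype.val '' A = B ∩ E

/-- The first uncountable ordinal. -/
noncomputable def omega1 : Ordinal.{0} := (Cardinal.aleph 1).ord

/-- `A` is an `F_σ`-set: a countable union of closed sets. -/
def IsFSigma {X : Type u} [TopologicalSpace X] (A : Set X) : Prop :=
  ∃ F : ℕ → Set X, (∀ n, IsClosed (F n)) ∧ A = ⋃ n, F n

/-- A space has a countable π-base. -/
def CountablePiBase (Z : Type v) [TopologicalSpace Z] : Prop :=
  ∃ 𝒰 : Set (Set Z), 𝒰.Countable ∧ (∀ U ∈ 𝒰, IsOpen U ∧ U.Nonempty) ∧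
    ∀ V : Set Z, IsOpen V → V.Nonempty → ∃ U ∈ 𝒰, U ⊆ V

theorem split_aux (R : ℕ → Set ℕ) (hR : ∀ k, (R k).Infinite) :
    ∃ S : Set ℕ, ∀ k, (∃ a ∈ R k, a ∈ S) ∧ (∃ b ∈ R k, b ∉ S) := by
  obtain ⟨g, hg, hgR⟩ := Filter.extraction_forall_of_frequently
    (P := fun m k => k ∈ R (m / 2))
    (fun m => Nat.frequently_atTop_iff_infinite.2 (hR (m / 2)))
  refine ⟨{x | ∃ m, x = g (2 * m)}, fun k => ⟨⟨g (2 * k), ?_, k, rfl⟩, g (2 * k + 1), ?_, ?_⟩⟩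
  · have := hgR (2 * k)
    rwa [show 2 * k / 2 = k by omega] at this
  · have := hgR (2 * k + 1)
    rwa [show (2 * k + 1) / 2 = k by omega] at this
  · rintro ⟨m, hm⟩
    have := hg.injective hm
    omega

theorem fsigma_of_compl {X : Type u} [TopologicalSpace X] {A : Set X} (h : IsGδ Aᶜ) :
    IsFSigma A := by
  obtain ⟨f, hf, hA⟩ := isGδ_iff_eq_iInter_nat.1 h
  refine ⟨fun n => (f n)ᶜ, fun n => (hf n).isClosed_compl, ?_⟩
  rw [← compl_compl A, hA, compl_iInter]

theorem rank_exists {X : Type u} [TopologicalSpace X]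
    (hmeager : ∃ F : ℕ → Set X, (∀ n, IsNowhereDense (F n)) ∧ (⋃ n, F n) = Set.univ) :
    ∃ r : X → ℕ, ∀ n, IsClosed {x | r x ≤ n} ∧ interior {x | r x ≤ n} = ∅ := by
  classical
  obtain ⟨F, hF, hU⟩ := hmeager
  have hex : ∀ x : X, ∃ n, x ∈ closure (F n) := fun x => by
    have : x ∈ ⋃ n, F n := hU ▸ mem_univ x
    obtain ⟨n, hn⟩ := mem_iUnion.1 this
    exact ⟨n, subset_closure hn⟩
  have key : ∀ n, IsClosed {x | Nat.find (hex x) ≤ n} ∧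
      interior {x | Nat.find (hex x) ≤ n} = ∅ := by
    intro n
    induction n with
    | zero =>
      have : {x | Nat.find (hex x) ≤ 0} = closure (F 0) := by
        ext x; simp [Nat.find_eq_zero]
      rw [this]
      exact ⟨isClosed_closure, hF 0⟩
    | succ n ih =>
      have : {x | Nat.find (hex x) ≤ n + 1} =
          closure (F (n + 1)) ∪ {x | Nat.find (hex x) ≤ n} := by
        ext x
        simp only [mem_ofPred_eq, mem_union, Nat.find_le_iff]
        constructor
        · rintro ⟨m, hm, hx⟩
          rcases Nat.lt_or_ge n m with h | h
          · obtain rfl : m = n + 1 := by omega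
            exact Or.inl hx
          · exact Or.inr ⟨m, h, hx⟩
        · rintro (h | ⟨m, hm, hx⟩)
          · exact ⟨n + 1, le_rfl, h⟩
          · exact ⟨m, by omega, hx⟩
      rw [this]
      refine ⟨isClosed_closure.union ih.1, ?_⟩
      rw [interior_union_isClosed_of_interior_empty isClosed_closure ih.2]
      exact hF (n + 1)
  exact ⟨fun x => Nat.find (hex x), key⟩

/-- a nonempty perfect space of the first category in itself with a countable
π-base splits into two disjoint dense sets which are both `F_σ` and `G_δ`. -/
theorem stmt14 {X : Type u} [TopologicalSpace X] [Nonempty X]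
    (hperf : ∀ F : Set X, IsClosed F → IsGδ F)
    (hmeager : ∃ F : ℕ → Set X, (∀ n, IsNowhereDense (F n)) ∧ (⋃ n, F n) = Set.univ)
    (hpibase : CountablePiBase X) :
    ∃ A B : Set X, Disjoint A B ∧ A ∪ B = Set.univ ∧ Dense A ∧ Dense B ∧
      IsFSigma A ∧ IsGδ A ∧ IsFSigma B ∧ IsGδ B := by
  classical
  obtain ⟨r, hr⟩ := rank_exists hmeager
  obtain ⟨𝒰, hc, hU, hpi⟩ := hpibase
  have hne : 𝒰.Nonempty := by
    obtain ⟨U, h, -⟩ := hpi univ isOpen_univ univ_nonempty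
    exact ⟨U, h⟩
  obtain ⟨f, rfl⟩ := hc.exists_eq_range hne
  have hinf : ∀ k, (r '' f k).Infinite := by
    intro k hfin
    obtain ⟨n, hn⟩ := hfin.bddAbove
    have hsub : f k ⊆ interior {x | r x ≤ n} :=
      interior_maximal (fun x hx => hn (mem_image_of_mem r hx)) (hU _ (mem_range_self k)).1
    rw [(hr n).2] at hsub
    obtain ⟨x, hx⟩ := (hU _ (mem_range_self k)).2
    exact hsub hx
  obtain ⟨S, hS⟩ := split_aux _ hinf
  have hG : ∀ T : Set ℕ, IsGδ (r ⁻¹' T) := by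
    intro T
    have : r ⁻¹' T = ⋂ n : ℕ, ⋂ _ : n ∉ T, ({x | r x < n} ∪ {x | r x ≤ n}ᶜ) := by
      ext x
      simp only [mem_preimage, mem_iInter, mem_union, mem_ofPred_eq, mem_compl_iff, not_le]
      constructor
      · intro hx n hn
        exact lt_or_gt_of_ne (fun h => hn (h ▸ hx))
      · intro h
        by_contra hx
        have := h _ hx
        omega
    rw [this]
    refine IsGδ.iInter fun n => IsGδ.iInter fun _ => IsGδ.union (hperf _ ?_) ?_
    · rcases n with _ | n
      · simp
      · simpa only [Nat.lt_succ_iff] using (hr n).1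
    · exact (hr n).1.isOpen_compl.isGδ
  have hD : ∀ T : Set ℕ, (∀ k, ∃ a ∈ r '' f k, a ∈ T) → Dense (r ⁻¹' T) := by
    intro T hT
    rw [dense_iff_inter_open]
    intro V hV hVn
    obtain ⟨_, ⟨k, rfl⟩, hk⟩ := hpi V hV hVn
    obtain ⟨_, ⟨x, hx, rfl⟩, hxT⟩ := hT k
    exact ⟨x, hk hx, hxT⟩
  refine ⟨r ⁻¹' S, r ⁻¹' Sᶜ, ?_, ?_, hD _ fun k => (hS k).1, hD _ fun k => (hS k).2,
    fsigma_of_compl ?_, hG _, fsigma_of_compl ?_, hG _⟩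
  · exact disjoint_compl_right.preimage r
  · rw [← preimage_union, union_compl_self, preimage_univ]
  · rw [← preimage_compl]; exact hG _
  · rw [← preimage_compl]; exact hG _
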